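/- Let R be a Hecke operator on V with dim_K V ≥ 2, assume the quantum integers [k]_q = 1 + q + ⋯ + q^{k−1} are nonzero in K for every integer k ≥ 1, and suppose R is an even Hecke operator of rank r, i.e. λ_r = 1 and λ_k = 0 for all k > r. Then 2 ≤ r ≤ dim_K V. (Theorem 3.2) -/

import Mathlib

open TensorProduct

/-- The Yang–Baxter equation for an operator `R` on `V ⊗ V`, stated on `(V ⊗ V) ⊗ V`:
`(R ⊗ 1)(1 ⊗ R)(R ⊗ 1) = (1 ⊗ R)(R ⊗ 1)(1 ⊗ R)`, where `1 ⊗ R` is transported along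
the associator. -/
def YangBaxter (K : Type*) [Field K] (V : Type*) [AddCommGroup V] [Module K V]
    (R : V ⊗[K] V →ₗ[K] V ⊗[K] V) : Prop :=
  let R₁ : (V ⊗[K] V) ⊗[K] V →ₗ[K] (V ⊗[K] V) ⊗[K] V := LinearMap.rTensor V R
  let R₂ : (V ⊗[K] V) ⊗[K] V →ₗ[K] (V ⊗[K] V) ⊗[K] V :=
    (TensorProduct.assoc K V V V).symm.toLinearMap ∘ₗ LinearMap.lTensor V R ∘ₗ
      (TensorProduct.assoc K V V V).toLinearMap
  R₁ ∘ₗ R₂ ∘ₗ R₁ = R₂ ∘ₗ R₁ ∘ₗ R₂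

/-- A Hecke operator on `V` for the parameter `q`: the Yang–Baxter equation together
with the Hecke equation `(R + 1)(R − q) = 0`. -/
def IsHecke (K : Type*) [Field K] (V : Type*) [AddCommGroup V] [Module K V]
    (q : K) (R : V ⊗[K] V →ₗ[K] V ⊗[K] V) : Prop :=
  YangBaxter K V R ∧ (R + LinearMap.id) ∘ₗ (R - q • LinearMap.id) = 0

/-- The multiplication map `V ⊗ V → T(V)` of the tensor algebra. -/
noncomputable def quadMul (K : Type*) [Field K] (V : Type*) [AddCommGroup V] [Module K V] :
    V ⊗[K] V →ₗ[K] TensorAlgebra K V :=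
  LinearMap.mul' K (TensorAlgebra K V) ∘ₗ
    TensorProduct.map (TensorAlgebra.ι K) (TensorAlgebra.ι K)

/-- The relation on `T(V)` identifying the image of `W ⊆ V ⊗ V` with zero; quotienting
by (the two-sided ideal generated by) it yields the quadratic algebra `T(V)/⟨W⟩`. -/
def quadRel (K : Type*) [Field K] (V : Type*) [AddCommGroup V] [Module K V]
    (W : Submodule K (V ⊗[K] V)) : TensorAlgebra K V → TensorAlgebra K V → Prop :=
  fun a b => b = 0 ∧ ∃ w ∈ W, a = quadMul K V w

/-- The dimension of the `n`-th homogeneous component of the quadratic algebra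
`T(V)/⟨W⟩`, realised as the image of the degree-`n` component of `T(V)` in the
quotient algebra. -/
noncomputable def quadDim (K : Type*) [Field K] (V : Type*) [AddCommGroup V] [Module K V]
    (W : Submodule K (V ⊗[K] V)) (n : ℕ) : ℕ :=
  Module.finrank K
    (Submodule.map (RingQuot.mkAlgHom K (quadRel K V W)).toLinearMap
      (LinearMap.range (TensorAlgebra.ι K (M := V)) ^ n))

/-- `λ_n`, the dimension of the `n`-th homogeneous component of `Λ = T(V)/⟨Im(R+1)⟩`. -/
noncomputable def lambdaDim (K : Type*) [Field K] (V : Type*) [AddCommGroup V] [Module K V]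
    (R : V ⊗[K] V →ₗ[K] V ⊗[K] V) (n : ℕ) : ℕ :=
  quadDim K V (LinearMap.range (R + LinearMap.id)) n

/-- `s_n`, the dimension of the `n`-th homogeneous component of `S = T(V)/⟨Im(R−q)⟩`. -/
noncomputable def sDim (K : Type*) [Field K] (V : Type*) [AddCommGroup V] [Module K V]
    (q : K) (R : V ⊗[K] V →ₗ[K] V ⊗[K] V) (n : ℕ) : ℕ :=
  quadDim K V (LinearMap.range (R - q • LinearMap.id)) n



structure HeckeRel {K : Type*} [Field K] {E : Type*} [AddCommGroup E] [Module K E]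
    (q : K) (T : ℕ → Module.End K E) : Prop where
  braid : ∀ k, T k * T (k+1) * T k = T (k+1) * T k * T (k+1)
  comm : ∀ j k, j + 1 < k → T j * T k = T k * T j
  quad : ∀ k, T k * T k = (q - 1) • T k + q • 1

noncomputable def JM {K : Type*} [Field K] {E : Type*} [AddCommGroup E] [Module K E]
    (q : K) (T : ℕ → Module.End K E) : ℕ → Module.End K E
  | 0 => 0
  | k+1 => q⁻¹ • (T k * JM q T k * T k) + q⁻¹ • T k

namespace HeckeRel

variable {K : Type*} [Field K] {E : Type*} [AddCommGroup E] [Module K E]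
    {q : K} {T : ℕ → Module.End K E}

lemma comm_hi (h : HeckeRel q T) (k j : ℕ) (hj : k < j) : T j * JM q T k = JM q T k * T j := by
  induction k with
  | zero => simp [JM]
  | succ k ih =>
    have ih := ih (by omega)
    have c := h.comm k j (by omega)
    simp only [JM, mul_add, add_mul, mul_smul_comm, smul_mul_assoc]
    congr 2
    · calc T j * (T k * JM q T k * T k) = (T j * T k) * JM q T k * T k := by noncomm_ring
        _ = T k * (T j * JM q T k) * T k := by rw [← c]; noncomm_ring
        _ = T k * JM q T k * (T j * T k) := by rw [ih]; noncomm_ring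
        _ = _ := by rw [← c]; noncomm_ring
    · exact c.symm

lemma comm_lo (hq : q ≠ 0) (h : HeckeRel q T) (k j : ℕ) (hj : j + 1 < k) :
    T j * JM q T k = JM q T k * T j := by
  induction k with
  | zero => omega
  | succ k ih =>
    rcases Nat.lt_or_ge (j+1) k with h1 | h1
    · have ih := ih h1
      have c := h.comm j k h1
      simp only [JM, mul_add, add_mul, mul_smul_comm, smul_mul_assoc]
      congr 2
      · calc T j * (T k * JM q T k * T k) = (T j * T k) * JM q T k * T k := by noncomm_ring
          _ = T k * (T j * JM q T k) * T k := by rw [c]; noncomm_ring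
          _ = T k * JM q T k * (T j * T k) := by rw [ih]; noncomm_ring
          _ = _ := by rw [c]; noncomm_ring
    · obtain rfl : k = j + 1 := by omega
      have b := h.braid j
      have c := h.comm_hi j (j+1) (by omega)
      have qd := h.quad j
      simp only [JM]
      generalize JM q T j = X at *
      generalize T (j+1) = A at *
      generalize T j = B at *
      have e1 : B * (A * B * X * B * A) = (A * B * X * B * A) * B := by
        calc B * (A * B * X * B * A) = (B * A * B) * X * B * A := by noncomm_ring
          _ = A * B * (A * X) * B * A := by rw [b]; noncomm_ring
          _ = A * B * X * (A * B * A) := by rw [c]; noncomm_ring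
          _ = _ := by rw [← b]; noncomm_ring
      have e2 : B * (A * B * A) + q • (B * A)= (A * B * A) * B + q • (A * B) := by
        have : B * (B * A * B) = (q-1) • (B * A * B) + q • (A * B) := by
          calc B * (B * A * B) = (B * B) * (A * B) := by noncomm_ring
            _ = _ := by rw [qd, add_mul, smul_mul_assoc, smul_mul_assoc, one_mul, mul_assoc]
        have h2 : (B * A * B) * B = (q-1) • (B * A * B) + q • (B * A) := by
          calc (B * A * B) * B = (B * A) * (B * B) := by noncomm_ring
            _ = _ := by rw [qd, mul_add, mul_smul_comm, mul_smul_comm, mul_one]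
        rw [← b, this, h2]; abel
      have e3 : q⁻¹ * q⁻¹ * q = q⁻¹ := by field_simp
      have : B * (q⁻¹ • (A * (q⁻¹ • (B * X * B) + q⁻¹ • B) * A) + q⁻¹ • A)
        = (q⁻¹ * q⁻¹) • (B * (A * B * X * B * A)) + (q⁻¹ * q⁻¹) • (B * (A * B * A) + q • (B * A)) := by
        simp only [mul_add, add_mul, mul_smul_comm, smul_mul_assoc, smul_add, smul_smul, e3]
        noncomm_ring
      rw [this, e1, e2]
      simp only [mul_add, add_mul, mul_smul_comm, smul_mul_assoc, smul_add, smul_smul, e3]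
      noncomm_ring

/-- `L_{k+1} T_k = T_k L_k + (q-1) L_{k+1} + 1` -/
lemma JM_T (hq : q ≠ 0) (h : HeckeRel q T) (k : ℕ) :
    JM q T (k+1) * T k = T k * JM q T k + (q - 1) • JM q T (k+1) + 1 := by
  have e : JM q T (k+1) * T k = q⁻¹ • (T k * JM q T k * (T k * T k)) + q⁻¹ • (T k * T k) := by
    simp only [JM, add_mul, smul_mul_assoc]; noncomm_ring
  rw [e, h.quad k]
  simp only [JM, mul_add, mul_smul_comm, smul_add, smul_smul, mul_one, inv_mul_cancel₀ hq, one_smul]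
  simp only [mul_comm q⁻¹ (q-1)]
  abel

lemma T_JM (hq : q ≠ 0) (h : HeckeRel q T) (k : ℕ) :
    T k * JM q T (k+1) = JM q T k * T k + (q - 1) • JM q T (k+1) + 1 := by
  have e : T k * JM q T (k+1) = q⁻¹ • ((T k * T k) * JM q T k * T k) + q⁻¹ • (T k * T k) := by
    simp only [JM, mul_add, mul_smul_comm]; noncomm_ring
  rw [e, h.quad k]
  simp only [JM, add_mul, smul_mul_assoc, smul_add, smul_smul, one_mul, inv_mul_cancel₀ hq, one_smul]
  simp only [mul_comm q⁻¹ (q-1)]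
  abel

lemma swap_vec (hq : q ≠ 0) (h : HeckeRel q T) (k : ℕ) (f : E) (hf : f ≠ 0) (a b : K)
    (ha : JM q T k f = a • f) (hb : JM q T (k+1) f = b • f)
    (hab : a ≠ b) (h1 : a ≠ q * b + 1) (h2 : b ≠ q * a + 1) :
    ∃ s : K, T k f + s • f ≠ 0 ∧ JM q T k (T k f + s • f) = b • (T k f + s • f) ∧
      JM q T (k+1) (T k f + s • f) = a • (T k f + s • f) := by
  have hab' : a - b ≠ 0 := sub_ne_zero.2 hab
  have e1 := congrArg (fun X : Module.End K E => X f) (h.JM_T hq k)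
  have e2 := congrArg (fun X : Module.End K E => X f) (h.T_JM hq k)
  have e3 := congrArg (fun X : Module.End K E => X f) (h.quad k)
  simp only [Module.End.mul_apply, LinearMap.add_apply, LinearMap.smul_apply, ha, hb, map_smul,
    Module.End.one_apply] at e1 e2 e3
  obtain ⟨s, hs⟩ : ∃ s : K, s * (a - b) = (q-1) * b + 1 := ⟨((q-1)*b+1)/(a-b), by field_simp⟩
  refine ⟨s, ?_, ?_, ?_⟩
  · intro h0
    have t : T k f = (-s) • f := by rw [neg_smul]; exact eq_neg_of_add_eq_zero_left h0
    rw [t, map_smul, t, smul_smul, smul_smul, ← add_smul] at e3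
    have e4 : ((s - 1) * (s + q)) • f = 0 := by
      rw [← sub_eq_zero, ← sub_smul] at e3
      rw [← e3]; congr 1; ring
    have e5 := (smul_eq_zero.1 e4).resolve_right hf
    rcases mul_eq_zero.1 e5 with e | e
    · obtain rfl : s = 1 := by linear_combination e
      exact h1 (by linear_combination hs)
    · obtain rfl : s = -q := by linear_combination e
      exact h2 (by linear_combination hs)
  · have e6 : JM q T k (T k f) = b • T k f - ((q-1)*b+1) • f := by
      rw [e2]; module
    rw [map_add, map_smul, e6, ha, ← hs]; module
  · rw [map_add, map_smul, e1, hb]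
    have : a • T k f + (q-1) • b • f + f + s • b • f = a • T k f + ((q-1)*b+1 + s * b) • f := by module
    rw [this, ← hs]; module

/-- descending product vectors -/
def desc (T : ℕ → Module.End K E) (r : ℕ) (g : E) : ℕ → E
  | 0 => g
  | d+1 => T (r - 1 - d) (desc T r g d)

lemma app_comm (h : HeckeRel q T) {j k : ℕ} (hjk : j + 1 < k ∨ k + 1 < j) (f : E) :
    T j (T k f) = T k (T j f) := by
  rcases hjk with c | c
  · exact congrArg (fun X : Module.End K E => X f) (h.comm j k c)
  · exact (congrArg (fun X : Module.End K E => X f) (h.comm k j c)).symm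

lemma desc_lo (h : HeckeRel q T) (r : ℕ) (g : E) (hg : ∀ k, k + 1 < r → T k g = - g)
    (d : ℕ) (k : ℕ) (hk : k + 1 + d < r) : T k (desc T r g d) = - desc T r g d := by
  induction d with
  | zero => exact hg k (by omega)
  | succ d ih =>
    simp only [desc]
    rw [h.app_comm (by omega), ih (by omega), map_neg]

/-- `desc d` is `w_{r-d}`. -/
lemma desc_hi (h : HeckeRel q T) (r : ℕ) (g : E) (hg : ∀ k, k + 1 < r → T k g = - g)
    (d : ℕ) (hd : d ≤ r) (k : ℕ) (hk : r < k + d) (hkr : k < r) :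
    T k (desc T r g d) = - desc T r g d := by
  induction d generalizing k with
  | zero => omega
  | succ d ih =>
    simp only [desc]
    rcases Nat.lt_or_ge (r - 1 - d + 1) k with c | c
    · rw [h.app_comm (by omega), ih (by omega) k (by omega) hkr, map_neg]
    · obtain ⟨d, rfl⟩ : ∃ d', d = d' + 1 := ⟨d - 1, by omega⟩
      obtain ⟨j, hj⟩ : ∃ j, j = r - 1 - (d + 1) := ⟨_, rfl⟩
      have hj' : r - 1 - d = j + 1 := by omega
      obtain rfl : k = j + 1 := by omega
      simp only [desc]
      rw [← hj, hj']
      have b := congrArg (fun X : Module.End K E => X (desc T r g d)) (h.braid j)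
      simp only [Module.End.mul_apply] at b
      rw [← b, h.desc_lo r g hg d j (by omega), map_neg, map_neg]

lemma JM_desc (hq : q ≠ 0) (h : HeckeRel q T) (r : ℕ) (g : E) (hg : ∀ k, k + 1 < r → T k g = - g)
    (m : ℕ) (hm : m < r) (k : ℕ) (hk : m ≤ k) (hkr : k < r) :
    T k (JM q T m (desc T r g (r - m))) = - JM q T m (desc T r g (r - m)) := by
  induction m generalizing k with
  | zero => simp [JM]
  | succ m ih =>
    have e : desc T r g (r - m) = T m (desc T r g (r - (m+1))) := by
      have : r - m = (r - (m+1)) + 1 := by omega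
      rw [this]; simp only [desc]; congr 2; omega
    have e2 : JM q T (m+1) (desc T r g (r - (m+1))) =
        q⁻¹ • (- JM q T m (desc T r g (r - m))) + q⁻¹ • desc T r g (r - m) := by
      rw [← ih (by omega) m le_rfl (by omega), e]
      simp [JM]
    rw [e2]
    have := h.desc_hi r g hg (r - m) (by omega) k (by omega) hkr
    simp only [map_add, map_smul, map_neg, ih (by omega) k (by omega) hkr, this]
    module

lemma JM_top (hq : q ≠ 0) (h : HeckeRel q T) (r : ℕ) (g : E)
    (hg : ∀ k, k + 1 < r → T k g = - g) (k : ℕ) (hk : k < r) :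
    T k (JM q T r g - g) = - (JM q T r g - g) := by
  rcases Nat.lt_or_ge (k+1) r with c | c
  · have := congrArg (fun X : Module.End K E => X g) (h.comm_lo hq r k c)
    simp only [Module.End.mul_apply] at this
    rw [map_sub, this, hg k c, map_neg]; abel
  · obtain rfl : r = k + 1 := by omega
    have e1 := congrArg (fun X : Module.End K E => X g) (h.T_JM hq k)
    have e2 := h.JM_desc hq (k+1) g hg k (by omega) k le_rfl (by omega)
    have e3 : JM q T (k+1) g = q⁻¹ • T k (JM q T k (T k g)) + q⁻¹ • T k g := by simp [JM]
    have e4 : desc T (k+1) g (k+1-k) = T k g := by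
      have : k + 1 - k = 0 + 1 := by omega
      rw [this]; simp [desc]
    rw [e4] at e2
    simp only [Module.End.mul_apply, LinearMap.add_apply, LinearMap.smul_apply,
      Module.End.one_apply] at e1
    rw [map_sub, e1]
    rw [e2] at e3
    have e5 : q • JM q T (k+1) g = - JM q T k (T k g) + T k g := by
      rw [e3, smul_add, smul_smul, smul_smul, mul_inv_cancel₀ hq, one_smul, one_smul]
    have : (q-1) • JM q T (k+1) g = q • JM q T (k+1) g - JM q T (k+1) g := by module
    rw [this, e5]; abel

lemma JM_anti (hq : q ≠ 0) (r : ℕ) (g : E)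
    (hg : ∀ k, k + 1 < r → T k g = - g) (c : ℤ → K) (c0 : c 0 = 0)
    (hc : ∀ m, c (m+1) = q * c m + 1) (k : ℕ) (hk : k < r) :
    JM q T k g = c (-(k:ℤ)) • g := by
  induction k with
  | zero => simp [JM, c0]
  | succ k ih =>
    have ih := ih (by omega)
    have t := hg k hk
    have : c (-(k:ℤ)) = q * c (-((k+1:ℕ):ℤ)) + 1 := by rw [← hc]; congr 1; push_cast; ring
    have e : c (-((k+1:ℕ):ℤ)) = q⁻¹ * (c (-(k:ℤ)) - 1) := by rw [this]; field_simp; ring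
    simp only [JM, LinearMap.add_apply, LinearMap.smul_apply, Module.End.mul_apply, t, map_neg, ih,
      map_smul, e]
    module

end HeckeRel


namespace Ballot

def addable (μ : ℕ → ℤ) (i : ℕ) : Prop := i = 0 ∨ μ i < μ (i - 1)

def stp (μ : ℕ → ℤ) (i : ℕ) : ℕ → ℤ := fun j => if j = i then μ j + 1 else μ j

def Bal : (ℕ → ℤ) → List ℕ → Prop
  | _, [] => True
  | μ, i :: w => addable μ i ∧ Bal (stp μ i) w

def cont : (ℕ → ℤ) → List ℕ → List ℤ
  | _, [] => []
  | μ, i :: w => (μ i - i) :: cont (stp μ i) w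

def fin (μ : ℕ → ℤ) (w : List ℕ) : ℕ → ℤ := w.foldl stp μ

lemma fin_append (μ) (u v : List ℕ) : fin μ (u ++ v) = fin (fin μ u) v := by
  simp [fin]

lemma fin_apply (w : List ℕ) (μ : ℕ → ℤ) (i : ℕ) : fin μ w i = μ i + w.count i := by
  induction w generalizing μ with
  | nil => simp [fin]
  | cons j w ih =>
    change fin (stp μ j) w i = _
    rw [ih, List.count_cons]
    by_cases h : i = j
    · subst h; simp [stp]; ring
    · have h' : ¬ (j = i) := fun e => h e.symm
      simp [stp, h, h']

lemma cont_append (u v : List ℕ) (μ) : cont μ (u ++ v) = cont μ u ++ cont (fin μ u) v := by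
  induction u generalizing μ with
  | nil => simp [fin, cont]
  | cons j w ih => simp [cont, ih, fin]

lemma bal_append (u v : List ℕ) (μ) : Bal μ (u ++ v) ↔ Bal μ u ∧ Bal (fin μ u) v := by
  induction u generalizing μ with
  | nil => simp [fin, Bal]
  | cons j w ih => simp [Bal, ih, fin, and_assoc]

lemma cont_length (u : List ℕ) (μ) : (cont μ u).length = u.length := by
  induction u generalizing μ with
  | nil => simp [cont]
  | cons j w ih => simp [cont, ih]

lemma cont_shift (r : ℕ) (w : List ℕ) (hw : ∀ i ∈ w, i < r) (μ ν : ℕ → ℤ)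
    (h : ∀ i < r, ν i = μ i + 1) : cont ν w = (cont μ w).map (· + 1) := by
  induction w generalizing μ ν with
  | nil => simp [cont]
  | cons j w ih =>
    have hj := h j (hw j (by simp))
    simp only [cont, List.map_cons, hj]
    rw [ih (fun i hi => hw i (by simp [hi])) (stp μ j) (stp ν j)]
    · congr 1; ring
    · intro i hi; simp only [stp, h i hi]; split_ifs <;> ring

lemma stp_comm (μ) (i j : ℕ) : stp (stp μ i) j = stp (stp μ j) i := by
  funext k; simp only [stp]; split_ifs <;> ring

lemma stp_anti {μ : ℕ → ℤ} (h : Antitone μ) {i : ℕ} (hi : addable μ i) : Antitone (stp μ i) := by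
  apply antitone_nat_of_succ_le
  intro k
  have h1 := h (Nat.le_succ k)
  simp only [stp, Nat.succ_eq_add_one] at *
  by_cases e1 : k + 1 = i
  · subst e1
    simp [addable] at hi
    simp; omega
  · simp only [e1, if_false]; split_ifs <;> omega

lemma bal_anti (w : List ℕ) {μ : ℕ → ℤ} (h : Antitone μ) (hw : Bal μ w) : Antitone (fin μ w) := by
  induction w generalizing μ with
  | nil => simpa [fin]
  | cons i w ih => exact ih (stp_anti h hw.1) hw.2

lemma gap {μ : ℕ → ℤ} (h : Antitone μ) {i j : ℕ} (hij : i < j) (hj : addable μ j) :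
    μ j - j + 2 ≤ μ i - i := by
  rcases hj with h0 | h0
  · omega
  · have : μ (j-1) ≤ μ i := h (by omega)
    omega

lemma gap' {μ : ℕ → ℤ} (h : Antitone μ) {i j : ℕ} (hij : i ≠ j) (hi : addable μ i)
    (hj : addable μ j) : μ j - j + 2 ≤ μ i - i ∨ μ i - i + 2 ≤ μ j - j := by
  rcases lt_or_gt_of_ne hij with c | c
  · exact Or.inl (gap h c hj)
  · exact Or.inr (gap h c hi)

lemma addable_stp {μ : ℕ → ℤ} {i j : ℕ} (hij : i ≠ j) (hi : addable μ i) :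
    addable (stp μ j) i := by
  rcases hi with h | h
  · exact Or.inl h
  · right; simp only [stp, hij, if_false]; split_ifs <;> omega

lemma cont_inj (w w' : List ℕ) {μ : ℕ → ℤ} (h : Antitone μ) (hw : Bal μ w) (hw' : Bal μ w')
    (e : cont μ w = cont μ w') : w = w' := by
  induction w generalizing μ w' with
  | nil => cases w' with
    | nil => rfl
    | cons => simp [cont] at e
  | cons i w ih => cases w' with
    | nil => simp [cont] at e
    | cons j w' =>
      simp only [cont, List.cons.injEq] at e
      have : i = j := by
        by_contra hij
        have := gap' h hij hw.1 hw'.1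
        omega
      subst this
      rw [ih w' (stp_anti h hw.1) hw.2 hw'.2 e.2]

lemma fin_range (μ) (k j : ℕ) : fin μ (List.range k) j = μ j + if j < k then 1 else 0 := by
  rw [fin_apply]
  congr 1
  by_cases h : j < k
  · simp [h, List.count_eq_one_of_mem List.nodup_range (List.mem_range.2 h)]
  · simp [h, List.count_eq_zero_of_not_mem (fun hh => h (List.mem_range.1 hh))]

lemma bal_range {μ : ℕ → ℤ} (h : Antitone μ) (k : ℕ) : Bal μ (List.range k) := by
  induction k with
  | zero => simp [Bal]
  | succ k ih =>
    rw [List.range_succ, bal_append]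
    refine ⟨ih, ?_, trivial⟩
    rcases Nat.eq_zero_or_pos k with h0 | h0
    · exact Or.inl h0
    · right
      rw [fin_range, fin_range]
      have := h (show k - 1 ≤ k by omega)
      simp; split_ifs <;> omega

section closure

variable (r : ℕ) (P : List ℤ → Prop)

lemma move
    (W2 : ∀ a b x y, x ≠ y → x ≠ y + 1 → y ≠ x + 1 → P (a ++ x :: y :: b) → P (a ++ y :: x :: b))
    (i : ℕ) (s v : List ℕ) (hs : i ∉ s) {μ : ℕ → ℤ} (h : Antitone μ) (hi : addable μ i)
    (hb : Bal μ s) (a : List ℤ) (hp : P (a ++ cont μ (s ++ i :: v))) :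
    P (a ++ cont μ (i :: (s ++ v))) := by
  induction s generalizing μ a with
  | nil => exact hp
  | cons j s ih =>
    have hij : i ≠ j := fun e => hs (by simp [e])
    have := ih (fun e => hs (by simp [e])) (stp_anti h hb.1) (addable_stp hij hi) hb.2
      (a ++ [μ j - j]) (by simpa [cont] using hp)
    have g := gap' h hij hi hb.1
    have e1 : stp μ j i = μ i := by simp [stp, hij]
    have e2 : stp μ i j = μ j := by simp [stp, hij.symm]
    simp only [cont, List.append_assoc, List.cons_append, List.nil_append, e1] at this
    simp only [cont, List.cons_append, e2]
    rw [stp_comm μ i j]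
    exact W2 _ _ _ _ (by omega) (by omega) (by omega) this

lemma step
    (W2 : ∀ a b x y, x ≠ y → x ≠ y + 1 → y ≠ x + 1 → P (a ++ x :: y :: b) → P (a ++ y :: x :: b))
    (i : ℕ) (hir : i < r) (v : List ℕ) {μ : ℕ → ℤ} (h : Antitone μ) (hi : addable μ i)
    (a : List ℤ) (hp : P (a ++ cont μ (List.range r ++ i :: v))) :
    P (a ++ cont μ (i :: (List.range r ++ v))) := by
  obtain ⟨s, hs⟩ : ∃ s, List.range r = List.range i ++ [i] ++ s := by
    rw [← List.range_succ]
    exact ⟨_, by rw [← List.range_add, ]; congr 1; exact (Nat.add_sub_cancel' hir).symm⟩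
  have hnd : (List.range i ++ [i] ++ s).Nodup := hs ▸ List.nodup_range
  have his : i ∉ s := by
    intro hh
    exact (List.nodup_append.1 hnd).2.2 i (by simp) i hh rfl
  have hb := bal_range h r
  rw [hs, bal_append] at hb
  have hanti := bal_anti _ h hb.1
  have hadd : addable (fin μ (List.range i ++ [i])) i := by
    rw [← List.range_succ]
    rcases hi with h0 | h0
    · exact Or.inl h0
    · right; rw [fin_range, fin_range]; split_ifs <;> omega
  rw [hs, List.append_assoc, cont_append, ← List.append_assoc] at hp
  have h1 := move P W2 i s v his hanti hadd hb.2 _ hp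
  have h2 := move P W2 i (List.range i) (i :: (s ++ v)) (by simp) h hi (bal_range h i) a (by
    rw [List.append_assoc, ← cont_append] at h1
    simpa using h1)
  rw [hs]
  simpa using h2

lemma moveAll
    (W2 : ∀ a b x y, x ≠ y → x ≠ y + 1 → y ≠ x + 1 → P (a ++ x :: y :: b) → P (a ++ y :: x :: b))
    (v u : List ℕ) (hv : ∀ i ∈ v, i < r) (hb : Bal 0 (u ++ v))
    (hp : P (cont 0 (u ++ List.range r ++ v))) : P (cont 0 (u ++ v ++ List.range r)) := by
  induction v generalizing u with
  | nil => simpa using hp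
  | cons i v ih =>
    have hb' := (bal_append _ _ _).1 hb
    have hanti : Antitone (fin 0 u) := bal_anti u (antitone_const) hb'.1
    rw [List.append_assoc, cont_append] at hp
    have := step r P W2 i (hv i (by simp)) v hanti hb'.2.1 _ hp
    have h2 := ih (u ++ [i]) (fun j hj => hv j (by simp [hj])) (by simpa using hb) (by
      rw [← cont_append] at this
      simpa using this)
    simpa using h2

lemma allBallot
    (W0 : P []) (W1 : ∀ a b, P (a ++ b) → P a)
    (W2 : ∀ a b x y, x ≠ y → x ≠ y + 1 → y ≠ x + 1 → P (a ++ x :: y :: b) → P (a ++ y :: x :: b))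
    (W3 : ∀ a, P a → P ((List.range r).map (fun i : ℕ => -(i:ℤ)) ++ a.map (· + 1)))
    (w : List ℕ) (hw : ∀ i ∈ w, i < r) (hb : Bal 0 w) : P (cont 0 w) := by
  induction w using List.reverseRecOn with
  | nil => simpa [cont] using W0
  | append_singleton w i ih =>
    have hw' : ∀ i ∈ w, i < r := fun j hj => hw j (by simp [hj])
    have hir : i < r := hw i (by simp)
    have hb' := (bal_append _ _ _).1 hb
    have h1 := W3 _ (ih hw' hb'.1)
    have e1 : (List.range r).map (fun i : ℕ => -(i:ℤ)) = cont 0 (List.range r) := by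
      clear h1 hir hw hw' W3 W2 ih
      induction r with
      | zero => simp [cont]
      | succ k ih => 
        rw [List.range_succ, List.map_append, cont_append, ih]
        simp [cont, fin_range]
    rw [e1, ← cont_shift r w hw' 0 (fin 0 (List.range r)) (by
      intro i hi; rw [fin_range]; simp [hi]), ← cont_append] at h1
    have h2 := moveAll r P W2 w [] hw' hb'.1 h1
    obtain ⟨s, hs⟩ : ∃ s, List.range r = List.range i ++ [i] ++ s := by
      rw [← List.range_succ]
      exact ⟨_, by rw [← List.range_add, ]; congr 1; exact (Nat.add_sub_cancel' hir).symm⟩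
    have hanti : Antitone (fin 0 w) := bal_anti w (antitone_const) hb'.1
    rw [cont_append, hs] at h2
    have h3 := move P W2 i (List.range i) s (by simp) hanti hb'.2.1 (bal_range hanti i) (cont 0 w)
      (by simpa using h2)
    rw [cont_append]
    apply W1 _ (cont (stp (fin 0 w) i) (List.range i ++ s))
    simpa [cont] using h3

end closure

/-! counting -/

lemma bal_of_gap (r : ℕ) (w : List ℕ) (hw : ∀ i ∈ w, i < r) (μ : ℕ → ℤ)
    (h : ∀ i, i + 1 < r → μ (i+1) + w.length ≤ μ i) : Bal μ w := by
  induction w generalizing μ with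
  | nil => trivial
  | cons i w ih =>
    refine ⟨?_, ih (fun j hj => hw j (by simp [hj])) _ ?_⟩
    · rcases i with _ | i
      · exact Or.inl rfl
      · have := h i (hw _ (by simp))
        right; simp at *; omega
    · intro j hj
      have := h j hj
      simp only [stp]; simp at *; split_ifs <;> omega

lemma exists_stair (r D : ℕ) : ∃ p : List ℕ, (∀ i ∈ p, i < r) ∧ Bal 0 p ∧
    ∀ i, i + 1 < r → fin 0 p (i+1) + D ≤ fin 0 p i := by
  induction D with
  | zero => exact ⟨[], by simp, trivial, by simp [fin]⟩
  | succ D ih =>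
    obtain ⟨p, hp, hb, hg⟩ := ih
    have key : ∀ m, m ≤ r → ∃ p : List ℕ, (∀ i ∈ p, i < r) ∧ Bal 0 p ∧
      (∀ i, i + 1 < r → fin 0 p (i+1) + D ≤ fin 0 p i) ∧
      ∀ i, i < m → i + 1 < r → fin 0 p (i+1) + (D + 1) ≤ fin 0 p i := by
      intro m
      induction m with
      | zero => intro _; exact ⟨p, hp, hb, hg, by simp⟩
      | succ m ih =>
        intro hm
        obtain ⟨p, hp, hb, hg, hg'⟩ := ih (by omega)
        refine ⟨p ++ List.range (m+1), ?_, ?_, ?_, ?_⟩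
        · intro i hi
          rcases List.mem_append.1 hi with h | h
          · exact hp i h
          · have := List.mem_range.1 h; omega
        · rw [bal_append]; exact ⟨hb, bal_range (bal_anti _ antitone_const hb) _⟩
        · intro i hi
          have := hg i hi
          rw [fin_append, fin_range, fin_range]; split_ifs <;> omega
        · intro i hi hi2
          have := hg i hi2
          have := hg' i
          rw [fin_append, fin_range, fin_range]; split_ifs <;> omega
    obtain ⟨p, h1, h2, _, h4⟩ := key r le_rfl
    exact ⟨p, h1, h2, fun i hi => by have := h4 i (by omega) hi; push_cast; omega⟩

/-- words of length L with common antitone content -/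
lemma exists_words (r L : ℕ) : ∃ A : Finset (List ℕ), r ^ L ≤ (L+1)^r * A.card ∧
    (∀ w ∈ A, w.length = L ∧ ∀ i ∈ w, i < r) ∧
    ∀ w ∈ A, ∀ i, i + 1 < r → w.count (i+1) ≤ w.count i := by
  classical
  let cnt : (Fin L → Fin r) → (Fin r → Fin (L+1)) := fun f i =>
    ⟨(Finset.univ.filter (fun k => f k = i)).card, by
      have := Finset.card_filter_le (Finset.univ : Finset (Fin L)) (fun k => f k = i)
      simp at this; omega⟩
  obtain ⟨c, hc⟩ : ∃ c, r ^ L ≤ (L+1)^r * (Finset.univ.filter (fun f => cnt f = c)).card := by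
    by_contra! hh
    have h1 : ∑ c, (Finset.univ.filter (fun f => cnt f = c)).card = r ^ L := by
      rw [← Finset.card_eq_sum_card_fiberwise (fun x _ => Finset.mem_univ _)]; simp
    have h2 : ∑ c : Fin r → Fin (L+1), ((L+1)^r * (Finset.univ.filter (fun f => cnt f = c)).card)
        < ∑ c : Fin r → Fin (L+1), r ^ L := 
      Finset.sum_lt_sum_of_nonempty ⟨fun _ => 0, Finset.mem_univ _⟩ (fun c _ => hh c)
    rw [← Finset.mul_sum, h1] at h2
    simp at h2
  let σ : Equiv.Perm (Fin r) := Tuple.sort (fun i => OrderDual.toDual (c i))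
  have hσ : Monotone ((fun i => OrderDual.toDual (c i)) ∘ σ) := Tuple.monotone_sort _
  let enc : (Fin L → Fin r) → List ℕ := fun f => List.ofFn (fun k => ((σ.symm (f k) : Fin r) : ℕ))
  have hinj : Function.Injective enc := by
    intro f g h
    have h := List.ofFn_injective h
    funext k
    have := congrFun h k
    exact σ.symm.injective (Fin.ext this)
  have hcount : ∀ f i (hi : i < r), (enc f).count i = (cnt f (σ ⟨i, hi⟩) : ℕ) := by
    intro f i hi
    simp only [enc, cnt]
    rw [← Multiset.coe_count, ← Fin.univ_val_map, Multiset.count_map]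
    change (Finset.univ.filter _).card = _
    congr 1
    ext k
    simp only [Finset.mem_filter, Finset.mem_univ, true_and]
    constructor
    · intro e
      rw [← Equiv.symm_apply_eq]
      exact Fin.ext e.symm
    · intro e
      simp [e]
  refine ⟨(Finset.univ.filter (fun f => cnt f = c)).image enc, ?_, ?_, ?_⟩
  · rwa [Finset.card_image_of_injective _ hinj]
  · intro w hw
    obtain ⟨f, hf, rfl⟩ := Finset.mem_image.1 hw
    refine ⟨by simp [enc], ?_⟩
    intro i hi
    simp only [enc, List.mem_ofFn] at hi
    obtain ⟨k, rfl⟩ := hi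
    exact Fin.is_lt _
  · intro w hw i hi
    obtain ⟨f, hf, rfl⟩ := Finset.mem_image.1 hw
    have hf : cnt f = c := by simpa using hf
    rw [hcount f i (by omega), hcount f (i+1) hi, hf]
    exact hσ (show (⟨i, by omega⟩ : Fin r) ≤ ⟨i+1, hi⟩ by simp [Fin.le_def])

lemma exists_prod (r L : ℕ) (A : Finset (List ℕ)) 
    (hA : ∀ w ∈ A, w.length = L ∧ ∀ i ∈ w, i < r)
    (hA' : ∀ w ∈ A, ∀ i, i + 1 < r → w.count (i+1) ≤ w.count i) :
    ∃ C : ℕ, ∀ k : ℕ, ∃ S : Finset (List ℕ), S.card = A.card ^ k ∧ 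
      ∀ w ∈ S, w.length = C + k * L ∧ (∀ i ∈ w, i < r) ∧ Bal 0 w := by
  classical
  obtain ⟨p, hp1, hp2, hp3⟩ := exists_stair r L
  refine ⟨p.length, fun k => ?_⟩
  suffices ∃ S : Finset (List ℕ), S.card = A.card ^ k ∧ 
      ∀ w ∈ S, w.length = p.length + k * L ∧ (∀ i ∈ w, i < r) ∧ Bal 0 w ∧ 
        ∀ i, i + 1 < r → fin 0 w (i+1) + L ≤ fin 0 w i by
    obtain ⟨S, h1, h2⟩ := this
    exact ⟨S, h1, fun w hw => ⟨(h2 w hw).1, (h2 w hw).2.1, (h2 w hw).2.2.1⟩⟩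
  induction k with
  | zero => exact ⟨{p}, by simp, by simpa using ⟨hp1, hp2, hp3⟩⟩
  | succ k ih =>
    obtain ⟨S, h1, h2⟩ := ih
    refine ⟨(S ×ˢ A).image (fun x => x.1 ++ x.2), ?_, ?_⟩
    · rw [Finset.card_image_of_injOn, Finset.card_product, h1, pow_succ]
      rintro ⟨a, b⟩ hab ⟨a', b'⟩ hab' e
      simp only [Finset.coe_product, Set.mem_prod, Finset.mem_coe] at hab hab'
      have := List.append_inj e (by rw [(h2 _ hab.1).1, (h2 _ hab'.1).1])
      exact Prod.ext this.1 this.2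
    · intro w hw
      obtain ⟨⟨a, b⟩, hab, rfl⟩ := Finset.mem_image.1 hw
      have hab := Finset.mem_product.1 hab
      obtain ⟨g1, g2, g3, g4⟩ := h2 _ hab.1
      obtain ⟨f1, f2⟩ := hA _ hab.2
      have f3 := hA' _ hab.2
      simp only at *
      refine ⟨by rw [List.length_append, g1, f1]; ring, ?_, ?_, ?_⟩
      · intro i hi
        rcases List.mem_append.1 hi with h | h
        · exact g2 i h
        · exact f2 i h
      · rw [bal_append]
        exact ⟨g3, bal_of_gap r b f2 _ (by rw [f1]; exact g4)⟩
      · intro i hi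
        rw [fin_append, fin_apply b, fin_apply b]
        have := g4 i hi
        have := f3 i hi
        omega

theorem main (r n : ℕ) (hn : 1 ≤ n) (P : List ℤ → Prop)
  (W0 : P []) (W1 : ∀ a b, P (a ++ b) → P a)
  (W2 : ∀ a b x y, x ≠ y → x ≠ y + 1 → y ≠ x + 1 → P (a ++ x :: y :: b) → P (a ++ y :: x :: b))
  (W3 : ∀ a, P a → P ((List.range r).map (fun i : ℕ => -(i:ℤ)) ++ a.map (· + 1)))
  (hcount : ∀ (S : Finset (List ℤ)) (N : ℕ), (∀ a ∈ S, a.length = N ∧ P a) → S.card ≤ n ^ N) :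
  r ≤ n := by
  classical
  have h1 : ∀ (S : Finset (List ℕ)) (N : ℕ), (∀ w ∈ S, w.length = N ∧ (∀ i ∈ w, i < r) ∧ Bal 0 w) →
      S.card ≤ n ^ N := by
    intro S N hS
    rw [← Finset.card_image_of_injOn (s := S) (f := cont 0)]
    · apply hcount
      intro a ha
      obtain ⟨w, hw, rfl⟩ := Finset.mem_image.1 ha
      obtain ⟨g1, g2, g3⟩ := hS w hw
      exact ⟨by rw [cont_length, g1], allBallot r P W0 W1 W2 W3 w g2 g3⟩
    · intro w hw w' hw' e
      exact cont_inj w w' antitone_const (hS w hw).2.2 (hS w' hw').2.2 e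
  have h2 : ∀ L, r ^ L ≤ (L+1)^r * n ^ L := by
    intro L
    obtain ⟨A, a1, a2, a3⟩ := exists_words r L
    obtain ⟨C, hC⟩ := exists_prod r L A a2 a3
    have h3 : ∀ k, A.card ^ k ≤ n ^ (C + k * L) := by
      intro k
      obtain ⟨S, s1, s2⟩ := hC k
      rw [← s1]; exact h1 S _ s2
    refine a1.trans (Nat.mul_le_mul_left _ ?_)
    by_contra! hlt
    have hx : 0 < n ^ L := by positivity
    -- (n^L + 1)^k ≤ n^C (n^L)^k
    have h4 : ∀ k, (n^L + 1)^k ≤ n ^ C * (n^L)^k := by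
      intro k
      calc (n^L+1)^k ≤ A.card ^ k := Nat.pow_le_pow_left hlt k
        _ ≤ _ := h3 k
        _ = _ := by rw [pow_add, mul_comm k L, pow_mul]
    have h5 : ∀ k : ℕ, k * (n^L)^(k-1) ≤ n ^ C * (n^L)^k := by
      intro k
      rcases k with _ | k
      · simp
      · refine le_trans ?_ (h4 (k+1))
        rw [add_pow]
        refine le_trans ?_ (Finset.single_le_sum (f := fun m => (n^L)^m * 1^(k+1-m) * ((k+1).choose m)) (fun _ _ => Nat.zero_le _) (Finset.mem_range.2 (show k < k+1+1 by omega)))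
        simp [mul_comm]
    have h6 := h5 (n^C * n^L + 1)
    rw [Nat.add_sub_cancel, pow_succ] at h6
    have : 0 < (n^L)^(n^C * n^L) := by positivity
    nlinarith
  by_contra! hlt
  have hn' : (0:ℝ) < n := by exact_mod_cast hn
  have hgt : (1:ℝ) < (r:ℝ)/n := by
    rw [one_lt_div hn']; exact_mod_cast hlt
  have ht := tendsto_pow_const_div_const_pow_of_one_lt r hgt
  have ht2 := ht.eventually (gt_mem_nhds (show (0:ℝ) < ((r:ℝ)/n)⁻¹ by positivity))
  obtain ⟨M, hM⟩ := Filter.eventually_atTop.1 ht2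
  have h7 := hM (M+1) (by omega)
  have h8 := h2 M
  have h8' : (r:ℝ)^M ≤ ((M:ℝ)+1)^r * (n:ℝ)^M := by exact_mod_cast h8
  have h9 : ((r:ℝ)/n)^M ≤ ((M:ℝ)+1)^r := by
    rw [div_pow, div_le_iff₀ (by positivity)]; exact h8'
  have hpos : (0:ℝ) < (r:ℝ)/n := by linarith
  rw [div_lt_iff₀ (by positivity), pow_succ] at h7
  push_cast at h7
  have : ((r:ℝ)/n)⁻¹ * (((r:ℝ)/n)^M * ((r:ℝ)/n)) = ((r:ℝ)/n)^M := by
    rw [mul_comm, mul_assoc, mul_inv_cancel₀ hpos.ne', mul_one]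
  rw [this] at h7
  linarith

end Ballot


namespace HeckeCoord

variable {K : Type*} [Field K] {V : Type*} [AddCommGroup V] [Module K V] {n : ℕ}
  (b : Module.Basis (Fin n) K V) (R : V ⊗[K] V →ₗ[K] V ⊗[K] V)

/-- matrix entries of `R` -/
noncomputable def Rm (i j : Fin n) (p : Fin n × Fin n) : K :=
  (b.tensorProduct b).repr (R (b i ⊗ₜ b j)) p

lemma R_eq (i j : Fin n) : R (b i ⊗ₜ b j) = ∑ p, Rm b R i j p • (b p.1 ⊗ₜ[K] b p.2) := by
  rw [← (b.tensorProduct b).sum_repr (R (b i ⊗ₜ b j))]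
  simp [Rm, Module.Basis.tensorProduct_apply']

def upd (x : ℕ → Fin n) (k : ℕ) (p : Fin n × Fin n) : ℕ → Fin n :=
  fun i => if i = k then p.1 else if i = k + 1 then p.2 else x i

noncomputable def Top (k : ℕ) : Module.End K ((ℕ → Fin n) → K) where
  toFun F x := ∑ p, Rm b R (x k) (x (k+1)) p * F (upd x k p)
  map_add' F G := by funext x; simp [mul_add, Finset.sum_add_distrib]
  map_smul' c F := by
    funext x; simp only [Pi.smul_apply, smul_eq_mul, RingHom.id_apply, Finset.mul_sum]
    exact Finset.sum_congr rfl (fun p _ => by ring)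

lemma Top_apply (k : ℕ) (F : (ℕ → Fin n) → K) (x) :
    Top b R k F x = ∑ p, Rm b R (x k) (x (k+1)) p * F (upd x k p) := rfl

noncomputable def phi2 (F : (ℕ → Fin n) → K) (x : ℕ → Fin n) (k : ℕ) : V ⊗[K] V →ₗ[K] K :=
  (b.tensorProduct b).constr K (fun p => F (upd x k p))

lemma phi2_b (F : (ℕ → Fin n) → K) (x : ℕ → Fin n) (k : ℕ) (i j : Fin n) :
    phi2 b F x k (b i ⊗ₜ b j) = F (upd x k (i, j)) := by
  rw [phi2, ← Module.Basis.tensorProduct_apply b b i j, Module.Basis.constr_basis]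

lemma phi2_R (F : (ℕ → Fin n) → K) (x y : ℕ → Fin n) (k : ℕ) (i j : Fin n) (hi : y k = i)
    (hj : y (k+1) = j) (h : ∀ m, m ≠ k → m ≠ k + 1 → y m = x m) :
    phi2 b F x k (R (b i ⊗ₜ b j)) = Top b R k F y := by
  rw [R_eq, map_sum, Top_apply, hi, hj]
  refine Finset.sum_congr rfl (fun p _ => ?_)
  rw [map_smul, phi2_b, smul_eq_mul]
  congr 2
  funext m; simp only [upd]; split_ifs with h1 h2
  · rfl
  · rfl
  · exact (h m h1 h2).symm

lemma upd_self (x : ℕ → Fin n) (k : ℕ) : upd x k (x k, x (k+1)) = x := by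
  funext m; simp only [upd]; split_ifs with h1 h2 <;> simp [*]

lemma Top_quad (q : K) (hR : IsHecke K V q R) (k : ℕ) :
    Top b R k * Top b R k = (q - 1) • Top b R k + q • 1 := by
  have hq2 : ∀ z, R (R z) = (q - 1) • R z + q • z := by
    intro z
    have := LinearMap.congr_fun hR.2 z
    simp only [LinearMap.comp_apply, LinearMap.add_apply, LinearMap.sub_apply, LinearMap.smul_apply,
      LinearMap.id_apply, LinearMap.zero_apply, map_sub, map_smul] at this
    rw [← sub_eq_zero, ← this]; module
  have key : ∀ F x, phi2 b (Top b R k F) x k = phi2 b F x k ∘ₗ R := by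
    intro F x
    apply (b.tensorProduct b).ext
    rintro ⟨i, j⟩
    rw [Module.Basis.tensorProduct_apply, phi2_b, LinearMap.comp_apply]
    symm
    apply phi2_R <;> simp +contextual [upd]
  ext F x
  have h1 : ∀ G : (ℕ → Fin n) → K, G x = phi2 b G x k (b (x k) ⊗ₜ b (x (k+1))) := by
    intro G; rw [phi2_b, upd_self]
  simp only [Module.End.mul_apply, LinearMap.add_apply, LinearMap.smul_apply, Module.End.one_apply,
    Pi.add_apply, Pi.smul_apply]
  rw [h1 (Top b R k (Top b R k F)), h1 F, h1 (Top b R k F), key, key, LinearMap.comp_apply,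
    LinearMap.comp_apply, hq2]
  simp

def upd3 (x : ℕ → Fin n) (k : ℕ) (p : (Fin n × Fin n) × Fin n) : ℕ → Fin n :=
  fun i => if i = k then p.1.1 else if i = k + 1 then p.1.2 else if i = k + 2 then p.2 else x i

noncomputable def phi3 (F : (ℕ → Fin n) → K) (x : ℕ → Fin n) (k : ℕ) :
    (V ⊗[K] V) ⊗[K] V →ₗ[K] K :=
  ((b.tensorProduct b).tensorProduct b).constr K (fun p => F (upd3 x k p))

lemma phi3_b (F : (ℕ → Fin n) → K) (x : ℕ → Fin n) (k : ℕ) (i j l : Fin n) :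
    phi3 b F x k ((b i ⊗ₜ b j) ⊗ₜ b l) = F (upd3 x k ((i, j), l)) := by
  rw [phi3, ← Module.Basis.tensorProduct_apply b b i j,
    ← Module.Basis.tensorProduct_apply (b.tensorProduct b) b, Module.Basis.constr_basis]

lemma phi3_R1 (F : (ℕ → Fin n) → K) (x : ℕ → Fin n) (k : ℕ) :
    phi3 b (Top b R k F) x k = phi3 b F x k ∘ₗ LinearMap.rTensor V R := by
  apply ((b.tensorProduct b).tensorProduct b).ext
  rintro ⟨⟨i, j⟩, l⟩
  rw [Module.Basis.tensorProduct_apply, Module.Basis.tensorProduct_apply, phi3_b,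
    LinearMap.comp_apply, LinearMap.rTensor_tmul, R_eq, sum_tmul, map_sum, Top_apply]
  refine Finset.sum_congr (by simp) (fun p _ => ?_)
  rw [← smul_tmul', map_smul, phi3_b, smul_eq_mul]
  congr 2
  · simp [upd3]
  · simp [upd3]
  · funext m; simp only [upd, upd3]; split_ifs <;> first | rfl | omega

lemma phi3_R2 (F : (ℕ → Fin n) → K) (x : ℕ → Fin n) (k : ℕ) :
    phi3 b (Top b R (k+1) F) x k = phi3 b F x k ∘ₗ
    ((TensorProduct.assoc K V V V).symm.toLinearMap ∘ₗ LinearMap.lTensor V R ∘ₗ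
      (TensorProduct.assoc K V V V).toLinearMap) := by
  apply ((b.tensorProduct b).tensorProduct b).ext
  rintro ⟨⟨i, j⟩, l⟩
  rw [Module.Basis.tensorProduct_apply, Module.Basis.tensorProduct_apply, phi3_b]
  simp only [LinearMap.comp_apply, LinearEquiv.coe_coe, TensorProduct.assoc_tmul, 
    LinearMap.lTensor_tmul]
  rw [R_eq, tmul_sum, map_sum, map_sum, Top_apply]
  refine Finset.sum_congr (by simp) (fun p _ => ?_)
  rw [tmul_smul, map_smul, map_smul, TensorProduct.assoc_symm_tmul, phi3_b, smul_eq_mul]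
  congr 2
  · simp [upd3]
  · simp [upd3]; intro h; omega
  · funext m; simp only [upd, upd3]; split_ifs <;> first | rfl | omega

lemma Top_braid (hR : YangBaxter K V R) (k : ℕ) :
    Top b R k * Top b R (k+1) * Top b R k = Top b R (k+1) * Top b R k * Top b R (k+1) := by
  ext F x
  have h1 : ∀ G : (ℕ → Fin n) → K, G x = phi3 b G x k ((b (x k) ⊗ₜ b (x (k+1))) ⊗ₜ b (x (k+2))) := by
    intro G; rw [phi3_b]; congr 1
    funext m; simp only [upd3]; split_ifs <;> simp [*]
  have hR' := hR
  simp only [YangBaxter] at hR'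
  simp only [Module.End.mul_apply]
  rw [h1 (Top b R k _), h1 (Top b R (k+1) _)]
  simp only [phi3_R1, phi3_R2]
  have := LinearMap.congr_fun hR' ((b (x k) ⊗ₜ b (x (k+1))) ⊗ₜ b (x (k+2)))
  simp only [LinearMap.comp_apply] at this ⊢
  rw [this]

lemma Top_comm (j k : ℕ) (hjk : j + 1 < k) : Top b R j * Top b R k = Top b R k * Top b R j := by
  ext F x
  simp only [Module.End.mul_apply, Top_apply, Finset.mul_sum]
  rw [Finset.sum_comm]
  refine Finset.sum_congr rfl (fun p _ => Finset.sum_congr rfl (fun p' _ => ?_))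
  have e1 : upd x j p' k = x k := by simp only [upd]; split_ifs <;> first | rfl | omega
  have e2 : upd x j p' (k+1) = x (k+1) := by simp only [upd]; split_ifs <;> first | rfl | omega
  have e3 : upd x k p j = x j := by simp only [upd]; split_ifs <;> first | rfl | omega
  have e4 : upd x k p (j+1) = x (j+1) := by simp only [upd]; split_ifs <;> first | rfl | omega
  have e5 : upd (upd x j p') k p = upd (upd x k p) j p' := by
    funext m; simp only [upd]; split_ifs <;> first | rfl | omega
  rw [e1, e2, e3, e4, e5]; ring

lemma heckeRel (q : K) (hR : IsHecke K V q R) : HeckeRel q (Top b R) :=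
  ⟨Top_braid b R hR.1, Top_comm b R, Top_quad b R q hR⟩

/-! dependence on the first coordinates -/

def dep (F : (ℕ → Fin n) → K) (N : ℕ) : Prop := ∀ x y : ℕ → Fin n, (∀ i < N, x i = y i) → F x = F y

lemma dep_Top {F : (ℕ → Fin n) → K} {N : ℕ} (h : dep F N) (k : ℕ) (hk : k + 1 < N) :
    dep (Top b R k F) N := by
  intro x y hxy
  rw [Top_apply, Top_apply, hxy k (by omega), hxy (k+1) hk]
  refine Finset.sum_congr rfl (fun p _ => ?_)
  rw [h (upd x k p) (upd y k p)]
  intro i hi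
  simp only [upd, hxy i hi]

/-- freezing the tail -/
def frz (x0 : ℕ → Fin n) (N : ℕ) : Module.End K ((ℕ → Fin n) → K) where
  toFun F x := F (fun i => if i < N then x i else x0 i)
  map_add' _ _ := rfl
  map_smul' _ _ := rfl

lemma frz_apply (x0 : ℕ → Fin n) (N : ℕ) (F : (ℕ → Fin n) → K) (x) :
    frz x0 N F x = F (fun i => if i < N then x i else x0 i) := rfl

lemma dep_frz (x0 : ℕ → Fin n) (N : ℕ) (F : (ℕ → Fin n) → K) : dep (frz x0 N F) N := by
  intro x y h
  rw [frz_apply, frz_apply]; congr 1; funext i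
  split_ifs with hi
  · exact h i hi
  · rfl

lemma frz_self (x0 : ℕ → Fin n) (N : ℕ) (F : (ℕ → Fin n) → K) : frz x0 N F x0 = F x0 := by
  rw [frz_apply]; congr 1; funext i; simp

lemma frz_Top (x0 : ℕ → Fin n) (N : ℕ) (F : (ℕ → Fin n) → K) (k : ℕ) (hk : k + 1 < N) :
    Top b R k (frz x0 N F) = frz x0 N (Top b R k F) := by
  funext x
  rw [Top_apply, frz_apply, Top_apply, if_pos (by omega), if_pos hk]
  refine Finset.sum_congr rfl (fun p _ => ?_)
  rw [frz_apply]
  congr 2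
  funext m; simp only [upd]; split_ifs <;> first | rfl | omega

lemma frz_JM (q : K) (x0 : ℕ → Fin n) (N : ℕ) (F : (ℕ → Fin n) → K) (k : ℕ) (hk : k < N) :
    JM q (Top b R) k (frz x0 N F) = frz x0 N (JM q (Top b R) k F) := by
  induction k generalizing F with
  | zero => simp [JM]
  | succ k ih =>
    simp only [JM, LinearMap.add_apply, LinearMap.smul_apply, Module.End.mul_apply, map_add,
      map_smul, frz_Top b R x0 N _ k hk, ih _ (by omega : k < N)]

/-- tensoring with `l` in front -/
def tht (l : (ℕ → Fin n) → K) (r : ℕ) : Module.End K ((ℕ → Fin n) → K) where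
  toFun F x := l x * F (fun i => x (r + i))
  map_add' _ _ := by funext x; simp [mul_add]
  map_smul' _ _ := by funext x; simp; ring

lemma tht_apply (l : (ℕ → Fin n) → K) (r : ℕ) (F x) :
    tht l r F x = l x * F (fun i => x (r + i)) := rfl

lemma tht_Top {l : (ℕ → Fin n) → K} {r : ℕ} (hl : dep l r) (F : (ℕ → Fin n) → K) (k : ℕ) :
    Top b R (r + k) (tht l r F) = tht l r (Top b R k F) := by
  funext x
  rw [Top_apply, tht_apply, Top_apply, Finset.mul_sum]
  refine Finset.sum_congr rfl (fun p _ => ?_)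
  rw [tht_apply, hl (upd x (r+k) p) x (by
    intro i hi; simp only [upd]; split_ifs <;> first | rfl | omega)]
  have : (fun i => upd x (r+k) p (r+i)) = upd (fun i => x (r+i)) k p := by
    funext m; simp only [upd]; split_ifs <;> first | rfl | omega
  rw [this, add_assoc]; ring

lemma tht_anti {l : (ℕ → Fin n) → K} {r : ℕ} (hl : ∀ k, k + 1 < r → Top b R k l = - l)
    (F : (ℕ → Fin n) → K) (k : ℕ) (hk : k + 1 < r) :
    Top b R k (tht l r F) = - tht l r F := by
  funext x
  have h1 := congrFun (hl k hk) x
  rw [Top_apply] at h1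
  rw [Top_apply, Pi.neg_apply, tht_apply, ← neg_mul, ← Pi.neg_apply l x, Pi.neg_apply, ← Pi.neg_apply l,
    ← h1, Finset.sum_mul]
  refine Finset.sum_congr rfl (fun p _ => ?_)
  have : (fun i => upd x k p (r+i)) = fun i => x (r+i) := by
    funext m; simp only [upd]; split_ifs <;> first | rfl | omega
  rw [tht_apply, this]; ring

lemma tht_JM (q : K) (hq : q ≠ 0) (hR : IsHecke K V q R) {l : (ℕ → Fin n) → K} {r : ℕ}
    (hld : dep l r) (hl : ∀ k, k + 1 < r → Top b R k l = - l)
    (hno : ∀ h : (ℕ → Fin n) → K, dep h (r+1) → (∀ k, k < r → Top b R k h = - h) → h = 0)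
    (F : (ℕ → Fin n) → K) (k : ℕ) :
    JM q (Top b R) (r + k) (tht l r F) = tht l r (q • JM q (Top b R) k F + F) := by
  have H := heckeRel b R q hR
  induction k generalizing F with
  | zero =>
    have h1 := H.JM_top hq r (tht l r F) (tht_anti b R hl F)
    have h2 : JM q (Top b R) r (tht l r F) - tht l r F = 0 := by
      funext x
      have := hno (frz x (r+1) (JM q (Top b R) r (tht l r F) - tht l r F)) (dep_frz _ _ _) (by
        intro k hk
        rw [frz_Top b R _ _ _ k (by omega), h1 k hk, map_neg])
      rw [← frz_self x (r+1) (JM q (Top b R) r (tht l r F) - tht l r F), this]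
    simpa [JM] using sub_eq_zero.1 h2
  | succ k ih =>
    have qd := congrArg (fun X : Module.End K ((ℕ → Fin n) → K) => X F) (H.quad k)
    simp only [Module.End.mul_apply, LinearMap.add_apply, LinearMap.smul_apply,
      Module.End.one_apply] at qd
    have : JM q (Top b R) (r + (k+1)) = q⁻¹ • (Top b R (r+k) * JM q (Top b R) (r+k) * Top b R (r+k))
        + q⁻¹ • Top b R (r+k) := rfl
    rw [this]
    simp only [JM, LinearMap.add_apply, LinearMap.smul_apply, Module.End.mul_apply]
    rw [tht_Top b R hld, ih, tht_Top b R hld, ← map_smul (tht l r), ← map_smul (tht l r), ← map_add]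
    congr 1
    rw [map_add, map_smul, qd]
    simp only [smul_add, smul_smul, mul_inv_cancel₀ hq, inv_mul_cancel₀ hq]
    have : q⁻¹ * (q - 1) = 1 - q⁻¹ := by field_simp
    rw [this]; module

end HeckeCoord


namespace HeckeCoord

variable {K : Type*} [Field K] {V : Type*} [AddCommGroup V] [Module K V] {n : ℕ}
  (b : Module.Basis (Fin n) K V) (R : V ⊗[K] V →ₗ[K] V ⊗[K] V)

/-- antisymmetric functions on words -/
noncomputable def Dsub : Submodule K (List (Fin n) → K) where
  carrier := {Ψ | ∀ u v i j, ∑ p, Rm b R i j p * Ψ (u ++ p.1 :: p.2 :: v) = - Ψ (u ++ i :: j :: v)}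
  add_mem' := by
    intro Ψ Ψ' h h' u v i j
    simp only [Pi.add_apply, mul_add, Finset.sum_add_distrib]
    rw [h u v i j, h' u v i j]; ring
  zero_mem' := by intro u v i j; simp
  smul_mem' := by
    intro c Ψ h u v i j
    simp only [Pi.smul_apply, smul_eq_mul, ← mul_neg, ← h u v i j, Finset.mul_sum]
    exact Finset.sum_congr rfl (fun p _ => by ring)

noncomputable def opD (i : Fin n) : Module.End K (Dsub b R) where
  toFun Ψ := ⟨fun y => Ψ.1 (y ++ [i]), by
    intro u v i' j'
    have := Ψ.2 u (v ++ [i]) i' j'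
    simpa using this⟩
  map_add' _ _ := rfl
  map_smul' _ _ := rfl

lemma opD_apply (i : Fin n) (Ψ : Dsub b R) (y) : (opD b R i Ψ).1 y = Ψ.1 (y ++ [i]) := rfl

noncomputable def repT : TensorAlgebra K V →ₐ[K] Module.End K (Dsub b R) :=
  TensorAlgebra.lift K (b.constr K (opD b R))

lemma repT_b (i : Fin n) : repT b R (TensorAlgebra.ι K (b i)) = opD b R i := by
  simp [repT]

lemma quadMul_b (i j : Fin n) : quadMul K V (b i ⊗ₜ b j) =
    TensorAlgebra.ι K (b i) * TensorAlgebra.ι K (b j) := by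
  simp [quadMul]

lemma repT_rel : ∀ x y, quadRel K V (LinearMap.range (R + LinearMap.id)) x y →
    repT b R x = repT b R y := by
  rintro x y ⟨rfl, w, ⟨z, rfl⟩, rfl⟩
  have : (repT b R).toLinearMap ∘ₗ quadMul K V ∘ₗ (R + LinearMap.id) = 0 := by
    apply (b.tensorProduct b).ext
    rintro ⟨i, j⟩
    rw [Module.Basis.tensorProduct_apply]
    simp only [LinearMap.comp_apply, LinearMap.add_apply, LinearMap.id_apply, R_eq, map_add, map_sum,
      map_smul, quadMul_b, AlgHom.toLinearMap_apply, map_mul, repT_b, LinearMap.zero_apply]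
    ext Ψ y
    have := Ψ.2 y [] i j
    simp only [LinearMap.add_apply, LinearMap.sum_apply, LinearMap.smul_apply, Module.End.mul_apply,
      LinearMap.zero_apply, Submodule.coe_add, Submodule.coe_sum, Submodule.coe_smul, Pi.add_apply,
      Finset.sum_apply, Pi.smul_apply, opD_apply, smul_eq_mul, List.append_assoc, List.singleton_append,
      Submodule.coe_zero, Pi.zero_apply]
    rw [this]; ring
  rw [map_zero]
  exact LinearMap.congr_fun this z

abbrev Lam := RingQuot (quadRel K V (LinearMap.range (R + LinearMap.id)))

noncomputable def mkL : TensorAlgebra K V →ₐ[K] Lam R := RingQuot.mkAlgHom K _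

noncomputable def repL : Lam R →ₐ[K] Module.End K (Dsub b R) :=
  RingQuot.liftAlgHom K ⟨repT b R, fun {x y} h => repT_rel b R x y h⟩

lemma repL_mk (t) : repL b R (mkL R t) = repT b R t := by
  simp [repL, mkL]

noncomputable def mon (w : List (Fin n)) : TensorAlgebra K V :=
  (w.map (fun i => TensorAlgebra.ι K (b i))).prod

lemma repT_mon (w : List (Fin n)) (Ψ : Dsub b R) (y) : (repT b R (mon b w) Ψ).1 y = Ψ.1 (y ++ w) := by
  induction w generalizing y with
  | nil => simp [mon]
  | cons i w ih =>
    have : mon b (i :: w) = TensorAlgebra.ι K (b i) * mon b w := by simp [mon]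
    rw [this, map_mul, repT_b, Module.End.mul_apply, opD_apply, ih]; simp

lemma mk_zero {w : List (Fin n)} (h : mkL R (mon b w) = 0) (Ψ : Dsub b R) : Ψ.1 w = 0 := by
  have := repT_mon b R w Ψ []
  rw [← repL_mk, h] at this
  simpa using this.symm

lemma mk_ne {w : List (Fin n)} (h : mkL R (mon b w) ≠ 0) : ∃ Ψ : Dsub b R, Ψ.1 w ≠ 0 := by
  obtain ⟨φ, hφ⟩ : ∃ φ : Module.Dual K (Lam R), φ (mkL R (mon b w)) ≠ 0 := by
    by_contra! hh
    exact h ((Module.forall_dual_apply_eq_zero_iff K _).1 hh)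
  refine ⟨⟨fun y => φ (mkL R (mon b y)), ?_⟩, hφ⟩
  intro u v i j
  have e : ∀ i j, mon b (u ++ i :: j :: v) = mon b u * quadMul K V (b i ⊗ₜ b j) * mon b v := by
    intro i j; rw [quadMul_b]; simp [mon, mul_assoc]
  have h0 : mkL R (quadMul K V (R (b i ⊗ₜ b j) + b i ⊗ₜ b j)) = 0 := by
    rw [← map_zero (mkL R)]
    exact RingQuot.mkAlgHom_rel K ⟨rfl, _, ⟨b i ⊗ₜ b j, rfl⟩, rfl⟩
  rw [R_eq, map_add, map_add, map_sum, map_sum] at h0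
  have h1 := congrArg (fun z => φ (mkL R (mon b u) * z * mkL R (mon b v))) h0
  simp only [e, map_mul]
  simp only [map_smul, mul_add, add_mul, Finset.mul_sum, Finset.sum_mul, mul_smul_comm, 
    smul_mul_assoc, map_add, map_sum, mul_zero, zero_mul, map_zero, smul_eq_mul] at h1
  exact eq_neg_of_add_eq_zero_left h1

lemma lambdaDim_eq (N : ℕ) : lambdaDim K V R N = Module.finrank K
    (Submodule.map (mkL R).toLinearMap (LinearMap.range (TensorAlgebra.ι K (M := V)) ^ N)) := rfl

lemma mon_mem (w : List (Fin n)) : mon b w ∈ LinearMap.range (TensorAlgebra.ι K (M := V)) ^ w.length := by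
  induction w with
  | nil => simp [mon]
  | cons i w ih =>
    have : mon b (i :: w) = TensorAlgebra.ι K (b i) * mon b w := by simp [mon]
    rw [this, List.length_cons, pow_succ']
    exact Submodule.mul_mem_mul ⟨_, rfl⟩ ih

lemma range_eq : LinearMap.range (TensorAlgebra.ι K (M := V)) =
    Submodule.span K (Set.range (fun i => TensorAlgebra.ι K (b i))) := by
  rw [LinearMap.range_eq_map, ← b.span_eq, Submodule.map_span, ← Set.range_comp]; rfl

lemma finiteL {K : Type*} [Field K] {V : Type*} [AddCommGroup V] [Module K V] {n : ℕ}
    (b : Module.Basis (Fin n) K V) (R : V ⊗[K] V →ₗ[K] V ⊗[K] V) (N : ℕ) : Module.Finite K (Submodule.map (mkL R).toLinearMap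
    (LinearMap.range (TensorAlgebra.ι K (M := V)) ^ N)) := by
  rw [Module.Finite.iff_fg]
  apply Submodule.FG.map
  apply Submodule.FG.pow
  rw [range_eq b]
  exact Submodule.fg_span (Set.finite_range _)

lemma lam_zero {N : ℕ} (h : lambdaDim K V R N = 0) (Ψ : Dsub b R) (w : List (Fin n))
    (hw : w.length = N) : Ψ.1 w = 0 := by
  rw [lambdaDim_eq] at h
  have := finiteL b R N
  rw [Submodule.finrank_eq_zero] at h
  apply mk_zero b R
  have : mkL R (mon b w) ∈ Submodule.map (mkL R).toLinearMap
    (LinearMap.range (TensorAlgebra.ι K (M := V)) ^ N) := ⟨_, hw ▸ mon_mem b w, rfl⟩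
  rwa [h, Submodule.mem_bot] at this

lemma lam_ne {N : ℕ} (h : lambdaDim K V R N ≠ 0) : ∃ (Ψ : Dsub b R) (w : List (Fin n)),
    w.length = N ∧ Ψ.1 w ≠ 0 := by
  by_contra! hh
  apply h
  rw [lambdaDim_eq]
  have : Submodule.map (mkL R).toLinearMap
    (LinearMap.range (TensorAlgebra.ι K (M := V)) ^ N) = ⊥ := by
    rw [eq_bot_iff, Submodule.map_le_iff_le_comap, range_eq b, Submodule.span_pow, Submodule.span_le]
    intro t ht
    obtain ⟨f, rfl⟩ := Set.mem_pow.1 ht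
    choose g hg using fun i => (f i).2
    have e : (List.ofFn fun i => ((f i : TensorAlgebra K V))).prod = mon b (List.ofFn g) := by
      rw [mon, List.map_ofFn]; congr 2; funext i; exact (hg i).symm
    rw [e]
    change mkL R (mon b (List.ofFn g)) ∈ (⊥ : Submodule K (Lam R))
    rw [Submodule.mem_bot]
    by_contra hne
    obtain ⟨Ψ, hΨ⟩ := mk_ne b R hne
    exact hΨ (hh Ψ _ (by simp))
  rw [this]; simp

lemma lam_one {K : Type*} [Field K] {V : Type*} [AddCommGroup V] [Module K V] {n : ℕ}
    (b : Module.Basis (Fin n) K V) (R : V ⊗[K] V →ₗ[K] V ⊗[K] V) (h : lambdaDim K V R 1 = 1) (hn : 2 ≤ n) : False := by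
  classical
  rw [lambdaDim_eq] at h
  have := finiteL b R 1
  let f : Fin n → Submodule.map (mkL R).toLinearMap
    (LinearMap.range (TensorAlgebra.ι K (M := V)) ^ 1) := fun i =>
      ⟨mkL R (mon b [i]), ⟨_, mon_mem b [i], rfl⟩⟩
  have hli : LinearIndependent K f := by
    rw [Fintype.linearIndependent_iffₛ]
    intro g g' hg j
    let Ψ : Dsub b R := ⟨fun y => if y = [j] then 1 else 0, by
      intro u v i j'
      have : ∀ a c : Fin n, ¬ (u ++ a :: c :: v = [j]) := by
        intro a c e
        have := congrArg List.length e
        simp at this; omega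
      simp [this]⟩
    have h1 := congrArg Subtype.val hg
    simp only [f, Submodule.coe_sum, Submodule.coe_smul, Submodule.coe_zero] at h1
    have h2 := congrArg (fun z => (repL b R z Ψ).1 []) h1
    simp only [map_sum, map_smul, repL_mk, LinearMap.sum_apply, LinearMap.smul_apply, 
      Submodule.coe_sum, Submodule.coe_smul, Finset.sum_apply, Pi.smul_apply, repT_mon] at h2
    simpa [Ψ] using h2
  have := hli.fintype_card_le_finrank
  simp at this
  omega

/-! translation to sequences -/

lemma split_range (x : ℕ → Fin n) (r k : ℕ) (hk : k + 1 < r) : ∃ u v : List (Fin n), ∀ p,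
    (List.range r).map (upd x k p) = u ++ p.1 :: p.2 :: v := by
  obtain ⟨d, rfl⟩ : ∃ d, r = k + (d + 2) := ⟨r - k - 2, by omega⟩
  refine ⟨(List.range k).map x, (List.range d).map (fun i => x (k + (i + 2))), fun p => ?_⟩
  rw [List.range_add, List.map_append, List.range_succ_eq_map, List.range_succ_eq_map]
  congr 1
  · apply List.map_congr_left
    intro i hi
    have := List.mem_range.1 hi
    simp only [upd]; split_ifs <;> first | rfl | omega
  · simp only [List.map_cons, List.map_map]
    congr 1
    · simp [upd]
    · congr 1
      · simp [upd]
      · apply List.map_congr_left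
        intro i hi
        simp only [upd, Function.comp]; split_ifs <;> first | rfl | omega

lemma exists_l {r : ℕ} (h : lambdaDim K V R r ≠ 0) (i0 : Fin n) : ∃ l : (ℕ → Fin n) → K, l ≠ 0 ∧ dep l r ∧
    ∀ k, k + 1 < r → Top b R k l = - l := by
  obtain ⟨Ψ, w, hw, hΨ⟩ := lam_ne b R h
  refine ⟨fun x => Ψ.1 ((List.range r).map x), ?_, ?_, ?_⟩
  · intro h0
    have := congrFun h0 (fun i => w.getD i i0)
    apply hΨ
    rw [Pi.zero_apply] at this
    have e : w = (List.range r).map (fun i => w.getD i i0) := by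
      apply List.ext_getElem
      · simp [hw]
      · intro i h1 h2; simp [h1]
    exact (congrArg Ψ.1 e).trans this
  · intro x y hxy
    have e : (List.range r).map x = (List.range r).map y :=
      List.map_congr_left (fun i hi => hxy i (List.mem_range.1 hi))
    exact congrArg Ψ.1 e
  · intro k hk
    funext x
    obtain ⟨u, v, huv⟩ := split_range x r k hk
    have h1 := huv (x k, x (k+1))
    rw [upd_self] at h1
    rw [Top_apply, Pi.neg_apply, h1]
    simp only [huv]
    exact Ψ.2 u v _ _

lemma no_l {N : ℕ} (h : lambdaDim K V R N = 0) (f : (ℕ → Fin n) → K) (hf : dep f N)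
    (hT : ∀ k, k + 1 < N → Top b R k f = - f) : f = 0 := by
  classical
  funext x
  let sq : List (Fin n) → (ℕ → Fin n) := fun y i => y.getD i (x 0)
  let Ψ : Dsub b R := ⟨fun y => if y.length = N then f (sq y) else 0, by
    intro u v i j
    simp only [List.length_append, List.length_cons]
    by_cases hN : u.length + (v.length + 1 + 1) = N
    · simp only [hN, if_true]
      have := congrFun (hT u.length (by omega)) (sq (u ++ i :: j :: v))
      rw [Pi.neg_apply, Top_apply] at this
      rw [← this]
      refine Finset.sum_congr rfl (fun p _ => ?_)
      congr 1
      · congr 1 <;> simp [sq]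
      · congr 1
        funext m
        simp only [sq, upd]
        rcases lt_trichotomy m u.length with hm | hm | hm
        · rw [if_neg (by omega), if_neg (by omega)]
          simp [List.getElem?_append_left hm]
        · simp [hm]
        · obtain ⟨d, rfl⟩ : ∃ d, m = u.length + (d + 1) := ⟨m - u.length - 1, by omega⟩
          rcases d with _ | d
          · simp
          · rw [if_neg (by omega), if_neg (by omega)]
            simp only [List.getD_eq_getElem?_getD]
            rw [List.getElem?_append_right (by omega), List.getElem?_append_right (by omega),
              Nat.add_sub_cancel_left]
            simp
    · simp [hN]⟩
  have h1 := lam_zero b R h Ψ ((List.range N).map x) (by simp)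
  simp only [Ψ, List.length_map, List.length_range, if_true] at h1
  rw [Pi.zero_apply, ← h1]
  apply hf
  intro i hi
  simp [sq, hi]

/-! weights -/

def Wt (q : K) (c : ℤ → K) (a : List ℤ) : Prop :=
  ∃ F : (ℕ → Fin n) → K, F ≠ 0 ∧ dep F a.length ∧
    ∀ k z, a[k]? = some z → JM q (Top b R) k F = c z • F

lemma Wt_nil (q : K) (c : ℤ → K) (i0 : Fin n) : Wt b R q c [] := by
  refine ⟨fun _ => 1, ?_, ?_, ?_⟩
  · intro h; exact one_ne_zero (congrFun h (fun _ => i0))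
  · intro x y _; rfl
  · intro k z h; simp at h

lemma Wt_prefix (q : K) (c : ℤ → K) (a a' : List ℤ) (h : Wt b R q c (a ++ a')) : Wt b R q c a := by
  obtain ⟨F, h0, h1, h2⟩ := h
  obtain ⟨x, hx⟩ := Function.ne_iff.1 h0
  refine ⟨frz x a.length F, ?_, dep_frz _ _ _, ?_⟩
  · intro h; apply hx
    rw [← frz_self x a.length F, h]
  · intro k z hk
    have hk' : k < a.length := (List.getElem?_eq_some_iff.1 hk).1
    rw [frz_JM b R q x a.length F k hk', h2 k z (by rw [List.getElem?_append_left hk', hk]), map_smul]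

lemma Wt_swap (q : K) (hq : q ≠ 0) (hR : IsHecke K V q R) (c : ℤ → K) (hc : ∀ m, c (m+1) = q * c m + 1)
    (hci : Function.Injective c) (a a' : List ℤ) (x y : ℤ) (h1 : x ≠ y) (h2 : x ≠ y + 1) (h3 : y ≠ x + 1)
    (h : Wt b R q c (a ++ x :: y :: a')) : Wt b R q c (a ++ y :: x :: a') := by
  have H := heckeRel b R q hR
  obtain ⟨F, f0, f1, f2⟩ := h
  have ex := f2 a.length x (by simp)
  have ey := f2 (a.length + 1) y (by simp)
  obtain ⟨s, s0, s1, s2⟩ := H.swap_vec hq a.length F f0 (c x) (c y) ex ey (fun e => h1 (hci e))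
    (by rw [← hc]; exact fun e => h2 (hci e)) (by rw [← hc]; exact fun e => h3 (hci e))
  refine ⟨_, s0, ?_, ?_⟩
  · have d1 : dep F (a ++ y :: x :: a').length := by simpa using f1
    have d2 := dep_Top b R d1 a.length (by simp)
    intro u v huv
    simp only [Pi.add_apply, Pi.smul_apply]
    rw [d1 u v huv, d2 u v huv]
  · intro k z hk
    have comm : ∀ g, k ≠ a.length → k ≠ a.length + 1 →
        JM q (Top b R) k (Top b R a.length g) = Top b R a.length (JM q (Top b R) k g) := by
      intro g hk1 hk2
      rcases Nat.lt_or_ge k a.length with hlt | hge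
      · exact (congrArg (fun X : Module.End K ((ℕ → Fin n) → K) => X g)
          (H.comm_hi k a.length hlt)).symm
      · exact (congrArg (fun X : Module.End K ((ℕ → Fin n) → K) => X g)
          (H.comm_lo hq k a.length (by omega))).symm
    by_cases k1 : k = a.length
    · subst k1
      obtain rfl : y = z := by simpa using hk
      exact s1
    by_cases k2 : k = a.length + 1
    · subst k2
      obtain rfl : x = z := by simpa using hk
      exact s2
    have hk' : (a ++ x :: y :: a')[k]? = some z := by
      rw [← hk]
      rcases Nat.lt_or_ge k a.length with hlt | hge
      · rw [List.getElem?_append_left hlt, List.getElem?_append_left hlt]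
      · obtain ⟨d, rfl⟩ : ∃ d, k = a.length + (d + 2) := ⟨k - a.length - 2, by omega⟩
        rw [List.getElem?_append_right (by omega), List.getElem?_append_right (by omega),
          Nat.add_sub_cancel_left]
        simp
    have e := f2 k z hk'
    rw [map_add, comm F k1 k2, map_smul, e, map_smul]
    module

lemma Wt_col (q : K) (hq : q ≠ 0) (hR : IsHecke K V q R) (c : ℤ → K) (hc : ∀ m, c (m+1) = q * c m + 1)
    (c0 : c 0 = 0) {l : (ℕ → Fin n) → K} {r : ℕ} (hl0 : l ≠ 0)
    (hld : dep l r) (hl : ∀ k, k + 1 < r → Top b R k l = - l)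
    (hno : ∀ h : (ℕ → Fin n) → K, dep h (r+1) → (∀ k, k < r → Top b R k h = - h) → h = 0)
    (a : List ℤ) (h : Wt b R q c a) :
    Wt b R q c ((List.range r).map (fun i : ℕ => -(i:ℤ)) ++ a.map (· + 1)) := by
  obtain ⟨F, f0, f1, f2⟩ := h
  obtain ⟨x, hx⟩ := Function.ne_iff.1 hl0
  obtain ⟨y, hy⟩ := Function.ne_iff.1 f0
  refine ⟨tht l r F, ?_, ?_, ?_⟩
  · intro h
    have := congrFun h (fun i => if i < r then x i else y (i - r))
    rw [tht_apply, hld _ x (by intro i hi; simp [hi])] at this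
    simp at this
    exact this.elim hx hy
  · intro u v huv
    simp only [List.length_append, List.length_map, List.length_range] at huv
    rw [tht_apply, tht_apply, hld u v (fun i hi => huv i (by omega)), f1 _ (fun i => v (r + i))
      (fun i hi => huv _ (by omega))]
  · intro k z hk
    rcases Nat.lt_or_ge k r with hlt | hge
    · rw [List.getElem?_append_left (by simpa using hlt)] at hk
      obtain rfl : -(k:ℤ) = z := by simpa [hlt] using hk
      exact HeckeRel.JM_anti hq r _ (tht_anti b R hl F) c c0 hc k hlt
    · obtain ⟨d, rfl⟩ : ∃ d, k = r + d := ⟨k - r, by omega⟩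
      rw [List.getElem?_append_right (by simp)] at hk
      simp at hk
      obtain ⟨z', hz', rfl⟩ := hk
      rw [tht_JM b R q hq hR hld hl hno, f2 d z' hz', ← map_smul, hc]
      congr 1; module

lemma Wt_count (q : K) (c : ℤ → K) (hci : Function.Injective c) (S : Finset (List ℤ)) (N : ℕ)
    (hS : ∀ a ∈ S, a.length = N ∧ Wt b R q c a) : S.card ≤ n ^ N := by
  classical
  choose F f0 f1 f2 using fun a : S => (hS a.1 a.2).2
  have sep : ∀ (a : S) (t : Finset S), a ∉ t → ∃ X : Module.End K ((ℕ → Fin n) → K),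
      (∃ α : K, α ≠ 0 ∧ X (F a) = α • F a) ∧ ∀ d ∈ t, X (F d) = 0 := by
    intro a t
    suffices a ∉ t → ∃ X : Module.End K ((ℕ → Fin n) → K),
      (∃ α : K, α ≠ 0 ∧ X (F a) = α • F a) ∧ (∀ d, ∃ β : K, X (F d) = β • F d) ∧ 
        ∀ d ∈ t, X (F d) = 0 by
      intro h; obtain ⟨X, h1, _, h2⟩ := this h; exact ⟨X, h1, h2⟩
    induction t using Finset.induction_on with
    | empty => intro _; exact ⟨1, ⟨1, one_ne_zero, by simp⟩, fun d => ⟨1, by simp⟩, by simp⟩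
    | insert e t he ih =>
      intro ha
      obtain ⟨X, ⟨α, hα, hX⟩, h2, h3⟩ := ih (fun h => ha (Finset.mem_insert_of_mem h))
      have hae : a ≠ e := fun h => ha (by simp [h])
      obtain ⟨k, hk⟩ : ∃ k, a.1[k]? ≠ e.1[k]? := by
        by_contra! hh
        exact hae (Subtype.ext (List.ext_getElem? hh))
      have hkN : k < N := by
        by_contra hkN
        apply hk
        rw [List.getElem?_eq_none (by rw [(hS _ a.2).1]; omega),
          List.getElem?_eq_none (by rw [(hS _ e.2).1]; omega)]
      have hka : ∀ d : S, ∃ z, d.1[k]? = some z := by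
        intro d
        exact ⟨_, List.getElem?_eq_getElem (by rw [(hS _ d.2).1]; exact hkN)⟩
      obtain ⟨za, hza⟩ := hka a
      obtain ⟨ze, hze⟩ := hka e
      have hne : c za ≠ c ze := by
        intro h; apply hk; rw [hza, hze, hci h]
      refine ⟨(JM q (Top b R) k - c ze • 1) * X, ⟨(c za - c ze) * α, mul_ne_zero (sub_ne_zero.2 hne) hα, ?_⟩,
        ?_, ?_⟩
      · simp only [Module.End.mul_apply, hX, map_smul, LinearMap.sub_apply, f2 a k za hza,
          LinearMap.smul_apply, Module.End.one_apply]
        module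
      · intro d
        obtain ⟨β, hβ⟩ := h2 d
        obtain ⟨zd, hzd⟩ := hka d
        refine ⟨(c zd - c ze) * β, ?_⟩
        simp only [Module.End.mul_apply, hβ, map_smul, LinearMap.sub_apply, f2 d k zd hzd,
          LinearMap.smul_apply, Module.End.one_apply]
        module
      · intro d hd
        rcases Finset.mem_insert.1 hd with rfl | hd
        · obtain ⟨β, hβ⟩ := h2 d
          simp only [Module.End.mul_apply, hβ, map_smul, LinearMap.sub_apply, f2 d k ze hze,
            LinearMap.smul_apply, Module.End.one_apply]
          module
        · rw [Module.End.mul_apply, h3 d hd, map_zero]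
  have hli : LinearIndependent K F := by
    rw [Fintype.linearIndependent_iff]
    intro g hg a
    obtain ⟨X, ⟨α, hα, hX⟩, h3⟩ := sep a (Finset.univ.erase a) (by simp)
    have := congrArg X hg
    rw [map_sum, map_zero, Finset.sum_eq_single a] at this
    · rw [map_smul, hX, smul_smul] at this
      have := (smul_eq_zero.1 this).resolve_right (f0 a)
      exact (mul_eq_zero.1 this).resolve_right hα
    · intro d _ hd
      rw [map_smul, h3 d (by simp [hd]), smul_zero]
    · simp
  rcases S.eq_empty_or_nonempty with rfl | ⟨a0, ha0⟩
  · simp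
  obtain ⟨x0, _⟩ := Function.ne_iff.1 (f0 ⟨a0, ha0⟩)
  let J : ((Fin N → Fin n) → K) →ₗ[K] ((ℕ → Fin n) → K) :=
    { toFun := fun G x => G (fun i => x i)
      map_add' := fun _ _ => rfl
      map_smul' := fun _ _ => rfl }
  let G : S → ((Fin N → Fin n) → K) := fun a y => F a (fun i => if h : i < N then y ⟨i, h⟩ else x0 i)
  have hJ : F = J ∘ G := by
    funext a x
    apply f1 a
    rw [(hS _ a.2).1]
    intro i hi
    simp [hi]
  have hG : LinearIndependent K G := by
    rw [hJ] at hli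
    exact LinearIndependent.of_comp J hli
  have := hG.fintype_card_le_finrank
  simpa using this

end HeckeCoord

/-- the content function -/
noncomputable def contentFn {K : Type*} [Field K] (q : K) (z : ℤ) : K :=
  open Classical in if q = 1 then (z : K) else (q ^ z - 1) / (q - 1)

lemma contentFn_zero {K : Type*} [Field K] (q : K) : contentFn q 0 = 0 := by
  simp [contentFn]

lemma contentFn_succ {K : Type*} [Field K] (q : K) (hq : q ≠ 0) (m : ℤ) :
    contentFn q (m + 1) = q * contentFn q m + 1 := by
  unfold contentFn
  split_ifs with h
  · subst h; push_cast; ring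
  · have h' : q - 1 ≠ 0 := sub_ne_zero.2 h
    rw [zpow_add_one₀ hq]
    field_simp
    ring

lemma contentFn_inj {K : Type*} [Field K] [CharZero K] (q : K) (hq : q ≠ 0)
    (hqint : ∀ k : ℕ, 1 ≤ k → (∑ i ∈ Finset.range k, q ^ i) ≠ 0) :
    Function.Injective (contentFn q) := by
  have key : q ≠ 1 → ∀ x y : ℤ, x < y → q ^ x ≠ q ^ y := by
    intro h x y hxy e
    obtain ⟨k, hk⟩ := Int.eq_ofNat_of_zero_le (sub_nonneg.2 hxy.le)
    have h1 : q ^ k = 1 := by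
      have : q ^ (y - x) = 1 := by
        rw [zpow_sub₀ hq, e, div_self (zpow_ne_zero _ hq)]
      rwa [hk, zpow_natCast] at this
    have h2 := geom_sum_mul q k
    rw [h1, sub_self] at h2
    exact (mul_eq_zero.1 h2).elim (hqint k (by omega)) (sub_ne_zero.2 h)
  intro x y hxy
  unfold contentFn at hxy
  split_ifs at hxy with h
  · exact_mod_cast hxy
  · have h' : q - 1 ≠ 0 := sub_ne_zero.2 h
    have e : q ^ x = q ^ y := by
      rw [div_left_inj' h'] at hxy
      exact sub_left_inj.1 hxy
    rcases lt_trichotomy x y with hl | hl | hl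
    · exact absurd e (key h _ _ hl)
    · exact hl
    · exact absurd e.symm (key h _ _ hl)

/-- Theorem 3.2: an even Hecke operator of rank `r` on a space `V` of dimension at
least `2` satisfies `2 ≤ r ≤ dim V`. -/
theorem even_hecke_rank_le_dim
    (K : Type*) [Field K] [CharZero K] (V : Type*) [AddCommGroup V] [Module K V]
    [FiniteDimensional K V] (q : K) (hq : q ≠ 0)
    (R : V ⊗[K] V →ₗ[K] V ⊗[K] V) (hR : IsHecke K V q R)
    (hqint : ∀ k : ℕ, 1 ≤ k → (∑ i ∈ Finset.range k, q ^ i) ≠ 0)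
    (hdim : 2 ≤ Module.finrank K V) (r : ℕ)
    (hr : lambdaDim K V R r = 1) (hr' : ∀ k, r < k → lambdaDim K V R k = 0) :
    2 ≤ r ∧ r ≤ Module.finrank K V := by
  classical
  let b := Module.finBasis K V
  have i0 : Fin (Module.finrank K V) := ⟨0, by omega⟩
  constructor
  · by_contra hlt
    have hcase : r = 0 ∨ r = 1 := by omega
    rcases hcase with rfl | rfl
    · have h1 := HeckeCoord.no_l b R (hr' 1 (by omega)) (fun _ => 1) (fun _ _ _ => rfl)
        (fun k hk => by omega)
      exact one_ne_zero (congrFun h1 (fun _ => i0))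
    · exact HeckeCoord.lam_one b R hr hdim
  · obtain ⟨l, hl0, hld, hl⟩ := HeckeCoord.exists_l b R (r := r) (by rw [hr]; exact one_ne_zero) i0
    have hno : ∀ h : (ℕ → Fin (Module.finrank K V)) → K, HeckeCoord.dep h (r + 1) →
        (∀ k, k < r → HeckeCoord.Top b R k h = - h) → h = 0 := fun h hd hT =>
      HeckeCoord.no_l b R (hr' (r + 1) (by omega)) h hd (fun k hk => hT k (by omega))
    have hc := contentFn_succ q hq
    have hci := contentFn_inj q hq hqint
    exact Ballot.main r (Module.finrank K V) (by omega) (HeckeCoord.Wt b R q (contentFn q))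
      (HeckeCoord.Wt_nil b R q _ i0)
      (HeckeCoord.Wt_prefix b R q _)
      (fun a a' x y => HeckeCoord.Wt_swap b R q hq hR _ hc hci a a' x y)
      (HeckeCoord.Wt_col b R q hq hR _ hc (contentFn_zero q) hl0 hld hl hno)
      (HeckeCoord.Wt_count b R q _ hci)
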